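/- Let (H, ·, 1, Δ, ε, S) be a Hopf algebra over a field k with S² = Id_H. Define a second multiplication on H by x ∘ y = y·x. Then (H, ∘, 1, Δ, ε, S) is a Hopf algebra and (H, ·, ∘, 1, Δ, ε, S, S) is a Hopf brace. Moreover, if H is cocommutative, the map c: H ⊗ H → H ⊗ H, c(x ⊗ y) = S(x₍₁₎)·y·x₍₂₎ ⊗ x₍₃₎, is a solution of the braid equation. -/

import Mathlib

/-! Common definitions for formalizing "Constructing Hopf braces" (Agore). -/

open TensorProduct LinearMap

namespace HopfBraceNL

universe u

variable (k : Type u) [Field k]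

section HopfStr

variable (V : Type u) [AddCommGroup V] [Module k V] [Coalgebra k V]

/-- The coalgebra `V` is cocommutative. -/
def IsCocomm : Prop :=
  (TensorProduct.comm k V V).toLinearMap ∘ₗ (Coalgebra.comul (R := k) (A := V)) =
    Coalgebra.comul (R := k) (A := V)

/-- A Hopf algebra structure on the underlying coalgebra of `V`: a multiplication, unit and
antipode making `V` a Hopf algebra whose comultiplication and counit are the given ones. -/
structure HopfStr where
  mul : V ⊗[k] V →ₗ[k] V
  one : V
  mul_assoc : ∀ a b c : V, mul (mul (a ⊗ₜ[k] b) ⊗ₜ[k] c) = mul (a ⊗ₜ[k] mul (b ⊗ₜ[k] c))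
  one_mul : ∀ a : V, mul (one ⊗ₜ[k] a) = a
  mul_one : ∀ a : V, mul (a ⊗ₜ[k] one) = a
  comul_mul : ∀ a b : V,
    Coalgebra.comul (R := k) (mul (a ⊗ₜ[k] b)) =
      TensorProduct.map mul mul
        (TensorProduct.tensorTensorTensorComm k V V V V
          (Coalgebra.comul (R := k) a ⊗ₜ[k] Coalgebra.comul (R := k) b))
  counit_mul : ∀ a b : V,
    Coalgebra.counit (R := k) (mul (a ⊗ₜ[k] b)) =
      Coalgebra.counit (R := k) a * Coalgebra.counit (R := k) b
  comul_one : Coalgebra.comul (R := k) one = one ⊗ₜ[k] one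
  counit_one : Coalgebra.counit (R := k) one = 1
  antipode : V →ₗ[k] V
  antipode_left :
    mul ∘ₗ rTensor V antipode ∘ₗ Coalgebra.comul =
      toSpanSingleton k V one ∘ₗ Coalgebra.counit
  antipode_right :
    mul ∘ₗ lTensor V antipode ∘ₗ Coalgebra.comul =
      toSpanSingleton k V one ∘ₗ Coalgebra.counit

variable {k V}

/-- The Hopf structure is commutative. -/
def HopfStr.IsComm (hs : HopfStr k V) : Prop :=
  ∀ x y : V, hs.mul (x ⊗ₜ[k] y) = hs.mul (y ⊗ₜ[k] x)

/-- The linear map `x ⊗ y ⊗ z ↦ (x₍₁₎ ∘ y)·S(x₍₂₎)·(x₍₃₎ ∘ z)` (Sweedler notation), the right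
hand side of the Hopf brace compatibility condition, written point-free.  Here `m` and `S` are
the multiplication and antipode of the first Hopf structure and `m'` the multiplication of the
second one. -/
noncomputable def braceRHS (m : V ⊗[k] V →ₗ[k] V) (S : V →ₗ[k] V)
    (m' : V ⊗[k] V →ₗ[k] V) : V ⊗[k] (V ⊗[k] V) →ₗ[k] V :=
  m ∘ₗ lTensor V m
    ∘ₗ TensorProduct.map m' (TensorProduct.map S m')
    ∘ₗ lTensor (V ⊗[k] V) (TensorProduct.assoc k V V V).toLinearMap
    ∘ₗ (TensorProduct.tensorTensorTensorComm k V (V ⊗[k] V) V V).toLinearMap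
    ∘ₗ rTensor (V ⊗[k] V)
        ((lTensor V (Coalgebra.comul (R := k))) ∘ₗ (Coalgebra.comul (R := k) (A := V)))

variable (k V) in
/-- A Hopf brace on the coalgebra `V`: two Hopf algebra structures subject to the compatibility
`x ∘ (y·z) = (x₍₁₎ ∘ y)·S(x₍₂₎)·(x₍₃₎ ∘ z)`. -/
structure HopfBrace where
  dot : HopfStr k V
  circ : HopfStr k V
  brace : circ.mul ∘ₗ lTensor V dot.mul = braceRHS dot.mul dot.antipode circ.mul

/-- A solution of the braid equation on `V ⊗ V`. -/
def SolvesBraid {W : Type u} [AddCommGroup W] [Module k W]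
    (c : W ⊗[k] W →ₗ[k] W ⊗[k] W) : Prop :=
  letI c₁ : (W ⊗[k] W) ⊗[k] W →ₗ[k] (W ⊗[k] W) ⊗[k] W := rTensor W c
  letI c₂ : (W ⊗[k] W) ⊗[k] W →ₗ[k] (W ⊗[k] W) ⊗[k] W :=
    (TensorProduct.assoc k W W W).symm.toLinearMap ∘ₗ lTensor W c ∘ₗ
      (TensorProduct.assoc k W W W).toLinearMap
  c₁ ∘ₗ c₂ ∘ₗ c₁ = c₂ ∘ₗ c₁ ∘ₗ c₂

end HopfStr

section Actions

variable {k}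
variable {A H : Type u}
  [AddCommGroup A] [Module k A] [Coalgebra k A]
  [AddCommGroup H] [Module k H] [Coalgebra k H]

/-- `(x, a) ↦ (x₍₁₎ ⊗ a₍₁₎) ⊗ (x₍₂₎ ⊗ a₍₂₎)`, as an element. -/
noncomputable def split (x : H) (a : A) : (H ⊗[k] A) ⊗[k] (H ⊗[k] A) :=
  TensorProduct.tensorTensorTensorComm k H H A A
    (Coalgebra.comul (R := k) x ⊗ₜ[k] Coalgebra.comul (R := k) a)

/-- `A` is a left module over the Hopf structure `hH` via `act`. -/
structure IsLeftModule (hH : HopfStr k H) (act : H ⊗[k] A →ₗ[k] A) : Prop where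
  one_act : ∀ a : A, act (hH.one ⊗ₜ[k] a) = a
  mul_act : ∀ (x y : H) (a : A),
    act (hH.mul (x ⊗ₜ[k] y) ⊗ₜ[k] a) = act (x ⊗ₜ[k] act (y ⊗ₜ[k] a))

/-- `A` is a left module over `hH`-op via `act`, i.e. `(xy) ▶ a = y ▶ (x ▶ a)`. -/
structure IsLeftOpModule (hH : HopfStr k H) (act : H ⊗[k] A →ₗ[k] A) : Prop where
  one_act : ∀ a : A, act (hH.one ⊗ₜ[k] a) = a
  mul_act : ∀ (x y : H) (a : A),
    act (hH.mul (x ⊗ₜ[k] y) ⊗ₜ[k] a) = act (y ⊗ₜ[k] act (x ⊗ₜ[k] a))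

/-- The measuring conditions: `x ▶ (ab) = (x₍₁₎ ▶ a)(x₍₂₎ ▶ b)` and `x ▶ 1 = ε(x)1`. -/
structure IsModuleAlgebraLaw (hA : HopfStr k A) (act : H ⊗[k] A →ₗ[k] A) : Prop where
  act_mul : ∀ (x : H) (a b : A),
    act (x ⊗ₜ[k] hA.mul (a ⊗ₜ[k] b)) =
      hA.mul (TensorProduct.map act act
        (TensorProduct.tensorTensorTensorComm k H H A A
          (Coalgebra.comul (R := k) x ⊗ₜ[k] (a ⊗ₜ[k] b))))
  act_one : ∀ x : H, act (x ⊗ₜ[k] hA.one) = Coalgebra.counit (R := k) x • hA.one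

/-- `act` is a coalgebra map: `Δ(x ▶ a) = (x₍₁₎ ▶ a₍₁₎) ⊗ (x₍₂₎ ▶ a₍₂₎)`,
`ε(x ▶ a) = ε(x)ε(a)`. -/
structure IsCoalgebraLaw (act : H ⊗[k] A →ₗ[k] A) : Prop where
  comul_act : ∀ (x : H) (a : A),
    Coalgebra.comul (R := k) (act (x ⊗ₜ[k] a)) = TensorProduct.map act act (split x a)
  counit_act : ∀ (x : H) (a : A),
    Coalgebra.counit (R := k) (act (x ⊗ₜ[k] a)) =
      Coalgebra.counit (R := k) x * Coalgebra.counit (R := k) a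

/-- `(A, act)` is a left `hH`-module algebra. -/
structure IsLeftModuleAlgebra (hH : HopfStr k H) (hA : HopfStr k A)
    (act : H ⊗[k] A →ₗ[k] A) : Prop where
  toIsLeftModule : IsLeftModule hH act
  toLaw : IsModuleAlgebraLaw hA act

/-- `(A, act)` is a left `hH`-module coalgebra. -/
structure IsLeftModuleCoalgebra (hH : HopfStr k H) (act : H ⊗[k] A →ₗ[k] A) : Prop where
  toIsLeftModule : IsLeftModule hH act
  toCoalgLaw : IsCoalgebraLaw act

/-- `(A, act)` is a left `hH`-module bialgebra. -/
structure IsLeftModuleBialgebra (hH : HopfStr k H) (hA : HopfStr k A)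
    (act : H ⊗[k] A →ₗ[k] A) : Prop where
  toIsLeftModule : IsLeftModule hH act
  toLaw : IsModuleAlgebraLaw hA act
  toCoalgLaw : IsCoalgebraLaw act

/-- `(A, act)` is a left `hH`-op-module bialgebra. -/
structure IsLeftOpModuleBialgebra (hH : HopfStr k H) (hA : HopfStr k A)
    (act : H ⊗[k] A →ₗ[k] A) : Prop where
  toIsLeftOpModule : IsLeftOpModule hH act
  toLaw : IsModuleAlgebraLaw hA act
  toCoalgLaw : IsCoalgebraLaw act

/-- `H` is a right module over the Hopf structure `hA` via `ract : H ⊗ A → H`. -/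
structure IsRightModule (hA : HopfStr k A) (ract : H ⊗[k] A →ₗ[k] H) : Prop where
  act_one : ∀ x : H, ract (x ⊗ₜ[k] hA.one) = x
  act_mul : ∀ (x : H) (a b : A),
    ract (x ⊗ₜ[k] hA.mul (a ⊗ₜ[k] b)) = ract (ract (x ⊗ₜ[k] a) ⊗ₜ[k] b)

/-- `ract` is a coalgebra map `H ⊗ A → H`. -/
structure IsRightCoalgebraLaw (ract : H ⊗[k] A →ₗ[k] H) : Prop where
  comul_act : ∀ (x : H) (a : A),
    Coalgebra.comul (R := k) (ract (x ⊗ₜ[k] a)) = TensorProduct.map ract ract (split x a)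
  counit_act : ∀ (x : H) (a : A),
    Coalgebra.counit (R := k) (ract (x ⊗ₜ[k] a)) =
      Coalgebra.counit (R := k) x * Coalgebra.counit (R := k) a

/-- `(H, ract)` is a right `hA`-module bialgebra:  in addition to the module and coalgebra
conditions, `(xy) ◁ a = (x ◁ a₍₁₎)(y ◁ a₍₂₎)` and `1 ◁ a = ε(a)1`. -/
structure IsRightModuleBialgebra (hA : HopfStr k A) (hH : HopfStr k H)
    (ract : H ⊗[k] A →ₗ[k] H) : Prop where
  toIsRightModule : IsRightModule hA ract
  mul_ract : ∀ (x y : H) (a : A),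
    ract (hH.mul (x ⊗ₜ[k] y) ⊗ₜ[k] a) =
      hH.mul (TensorProduct.map ract ract
        (TensorProduct.tensorTensorTensorComm k H H A A
          ((x ⊗ₜ[k] y) ⊗ₜ[k] Coalgebra.comul (R := k) a)))
  one_ract : ∀ a : A, ract (hH.one ⊗ₜ[k] a) = Coalgebra.counit (R := k) a • hH.one
  toCoalgLaw : IsRightCoalgebraLaw ract

/-- `(A, H, tri, quad)` is a matched pair of Hopf algebras. -/
structure IsMatchedPair (hA : HopfStr k A) (hH : HopfStr k H)
    (tri : H ⊗[k] A →ₗ[k] A) (quad : H ⊗[k] A →ₗ[k] H) : Prop where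
  tri_module : IsLeftModule hH tri
  tri_coalg : IsCoalgebraLaw tri
  quad_module : IsRightModule hA quad
  quad_coalg : IsRightCoalgebraLaw quad
  mp1 : ∀ x : H, tri (x ⊗ₜ[k] hA.one) = Coalgebra.counit (R := k) x • hA.one
  mp1' : ∀ a : A, quad (hH.one ⊗ₜ[k] a) = Coalgebra.counit (R := k) a • hH.one
  mp2 : ∀ (x : H) (a b : A),
    tri (x ⊗ₜ[k] hA.mul (a ⊗ₜ[k] b)) =
      hA.mul (lTensor A tri (TensorProduct.assoc k A H A
        ((TensorProduct.map tri quad (split x a)) ⊗ₜ[k] b)))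
  mp3 : ∀ (x y : H) (a : A),
    quad (hH.mul (x ⊗ₜ[k] y) ⊗ₜ[k] a) =
      hH.mul (rTensor H quad ((TensorProduct.assoc k H A H).symm
        (x ⊗ₜ[k] TensorProduct.map tri quad (split y a))))
  mp4 : ∀ (x : H) (a : A),
    TensorProduct.map quad tri (split x a) =
      TensorProduct.comm k A H (TensorProduct.map tri quad (split x a))

variable (k) in
/-- `(a ⊗ (u₁ ⊗ u₂)) ⊗ y ↦ mA (a ⊗ u₁) ⊗ mH (u₂ ⊗ y)`: the standard way to assemble
a multiplication on `A ⊗ H` from a middle term `u ∈ A ⊗ H`. -/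
noncomputable def sandwich (mA : A ⊗[k] A →ₗ[k] A) (mH : H ⊗[k] H →ₗ[k] H) :
    (A ⊗[k] (A ⊗[k] H)) ⊗[k] H →ₗ[k] A ⊗[k] H :=
  TensorProduct.map mA mH
    ∘ₗ (TensorProduct.assoc k (A ⊗[k] A) H H).toLinearMap
    ∘ₗ rTensor H (TensorProduct.assoc k A A H).symm.toLinearMap

variable (k) in
/-- `(m ⊗ n) ⊗ p ↦ (m ⊗ p) ⊗ n`. -/
noncomputable def rightComm (M N P : Type u) [AddCommGroup M] [Module k M]
    [AddCommGroup N] [Module k N] [AddCommGroup P] [Module k P] :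
    (M ⊗[k] N) ⊗[k] P →ₗ[k] (M ⊗[k] P) ⊗[k] N :=
  (TensorProduct.assoc k M P N).symm.toLinearMap
    ∘ₗ lTensor M (TensorProduct.comm k N P).toLinearMap
    ∘ₗ (TensorProduct.assoc k M N P).toLinearMap

/-- `(x, b) ↦ (x₍₁₎ ▷ b₍₁₎) ⊗ (x₍₂₎ ◁ b₍₂₎)`. -/
noncomputable def matchedEl (tri : H ⊗[k] A →ₗ[k] A) (quad : H ⊗[k] A →ₗ[k] H)
    (x : H) (b : A) : A ⊗[k] H :=
  TensorProduct.map tri quad (split x b)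

/-- `(x, b) ↦ (x₍₁₎ ▷ b) ⊗ x₍₂₎`. -/
noncomputable def smashEl (tri : H ⊗[k] A →ₗ[k] A) (x : H) (b : A) : A ⊗[k] H :=
  rTensor H tri (rightComm k H H A (Coalgebra.comul (R := k) x ⊗ₜ[k] b))

/-- `(x, b) ↦ b₍₁₎ ⊗ (x ◁ b₍₂₎)`. -/
noncomputable def rsmashEl (ract : H ⊗[k] A →ₗ[k] H) (x : H) (b : A) : A ⊗[k] H :=
  lTensor A ract (TensorProduct.leftComm k H A A (x ⊗ₜ[k] Coalgebra.comul (R := k) b))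

end Actions



section CocommutativePoints

open Coalgebra HopfAlgebra WithConv

variable {R A B C D H : Type*} [CommSemiring R]
  [AddCommMonoid A] [Module R A] [Coalgebra R A]
  [AddCommMonoid B] [Module R B] [Coalgebra R B]
  [AddCommMonoid C] [Module R C] [Coalgebra R C]
  [AddCommMonoid D] [Module R D] [Coalgebra R D]
  [Semiring H] [HopfAlgebra R H]

variable (R A B) in
/-- The first projection of a tensor product of coalgebras. -/
noncomputable def fstHom : A ⊗[R] B →ₗc[R] A :=
  (Coalgebra.TensorProduct.rid R R A).toCoalgHom.comp
    (Coalgebra.TensorProduct.map (CoalgHom.id R A) (counitCoalgHom R B))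

variable (R A B) in
/-- The second projection of a tensor product of coalgebras. -/
noncomputable def sndHom : A ⊗[R] B →ₗc[R] B :=
  (Coalgebra.TensorProduct.lid R B).toCoalgHom.comp
    (Coalgebra.TensorProduct.map (counitCoalgHom R A) (CoalgHom.id R B))

@[simp]
lemma fstHom_tmul (a : A) (b : B) : fstHom R A B (a ⊗ₜ b) = counit (R := R) b • a := rfl

@[simp]
lemma sndHom_tmul (a : A) (b : B) : sndHom R A B (a ⊗ₜ b) = counit (R := R) a • b := rfl

lemma sum_counit_right_smul (x : A) :
    ∑ i ∈ (ℛ R x).index, counit (R := R) ((ℛ R x).right i) • (ℛ R x).left i = x := by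
  have := congrArg (TensorProduct.rid R A) (sum_tmul_counit_eq (ℛ R x))
  simpa only [map_sum, TensorProduct.rid_tmul, one_smul] using this

lemma map_fstHom_comul_tmul {M : Type*} [AddCommMonoid M] [Module R M] (G : A ⊗[R] B →ₗ[R] M)
    (x : A) (y : B) :
    TensorProduct.map G (fstHom R A B).toLinearMap (comul (x ⊗ₜ[R] y)) =
      ∑ i ∈ (ℛ R x).index, G ((ℛ R x).left i ⊗ₜ y) ⊗ₜ (ℛ R x).right i := by
  rw [TensorProduct.comul_tmul]
  conv_lhs => rw [← (ℛ R x).eq, ← (ℛ R y).eq]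
  conv_rhs => rw [← sum_counit_right_smul (R := R) y]
  simp [TensorProduct.sum_tmul, TensorProduct.tmul_sum, ← TensorProduct.smul_tmul']
  exact Finset.sum_comm

lemma map_fstHom_left_comul_tmul {M : Type*} [AddCommMonoid M] [Module R M] (G : A ⊗[R] B →ₗ[R] M)
    (x : A) (y : B) :
    TensorProduct.map (fstHom R A B).toLinearMap G (comul (x ⊗ₜ[R] y)) =
      ∑ i ∈ (ℛ R x).index, (ℛ R x).left i ⊗ₜ G ((ℛ R x).right i ⊗ₜ y) := by
  rw [TensorProduct.comul_tmul]
  conv_lhs => rw [← (ℛ R x).eq, ← (ℛ R y).eq]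
  conv_rhs => rw [← sum_counit_smul (ℛ R y)]
  simp [TensorProduct.sum_tmul, TensorProduct.tmul_sum, TensorProduct.smul_tmul]
  exact Finset.sum_comm

lemma toConv_mul_fstHom_tmul (F : WithConv (H ⊗[R] A →ₗ[R] H)) (x : H) (y : A) :
    (F * toConv (fstHom R H A).toLinearMap) (x ⊗ₜ y) =
      ∑ i ∈ (ℛ R x).index, F ((ℛ R x).left i ⊗ₜ y) * (ℛ R x).right i := by
  rw [convMul_apply, ofConv_toConv, map_fstHom_comul_tmul]
  simp

lemma toConv_antipode_mul (f : C →ₗc[R] H) :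
    toConv (antipode R ∘ₗ f.toLinearMap) * toConv f.toLinearMap = 1 := by
  have h := LinearMap.convMul_comp_coalgHom_distrib
    (toConv (antipode R (A := H))) (toConv id) f
  rw [LinearMap.antipode_mul_id] at h
  apply ofConv_injective
  rw [id_comp] at h
  rw [← h]
  ext x
  simp [LinearMap.convOne_def]

lemma toConv_mul_antipode (f : C →ₗc[R] H) :
    toConv f.toLinearMap * toConv (antipode R ∘ₗ f.toLinearMap) = 1 := by
  have h := LinearMap.convMul_comp_coalgHom_distrib
    (toConv id) (toConv (antipode R (A := H))) f
  rw [LinearMap.id_mul_antipode] at h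
  apply ofConv_injective
  rw [id_comp] at h
  rw [← h]
  ext x
  simp [LinearMap.convOne_def]

variable [Coalgebra.IsCocomm R C] [Coalgebra.IsCocomm R D]

/-- The pairing `x ↦ f x₍₁₎ ⊗ g x₍₂₎` of two coalgebra maps out of a cocommutative coalgebra. -/
noncomputable def pairHom (f : C →ₗc[R] A) (g : C →ₗc[R] B) : C →ₗc[R] A ⊗[R] B :=
  (Coalgebra.TensorProduct.map f g).comp (comulCoalgHom R C)

lemma pairHom_toLinearMap (f : C →ₗc[R] A) (g : C →ₗc[R] B) :
    (pairHom f g).toLinearMap = TensorProduct.map f.toLinearMap g.toLinearMap ∘ₗ comul := rfl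

lemma pairHom_apply (f : C →ₗc[R] A) (g : C →ₗc[R] B) (x : C) :
    pairHom f g x = TensorProduct.map f.toLinearMap g.toLinearMap (comul x) := rfl

lemma pairHom_comp (f : C →ₗc[R] A) (g : C →ₗc[R] B) (h : D →ₗc[R] C) :
    (pairHom f g).comp h = pairHom (f.comp h) (g.comp h) := by
  ext x
  simp [pairHom_apply, ← CoalgHomClass.map_comp_comul_apply, TensorProduct.map_map]

lemma fstHom_comp_pairHom (f : C →ₗc[R] A) (g : C →ₗc[R] B) :
    (fstHom R A B).comp (pairHom f g) = f := by
  ext x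
  conv_rhs => rw [← sum_counit_right_smul (R := R) x]
  simp [pairHom_apply, ← (ℛ R x).eq]

lemma sndHom_comp_pairHom (f : C →ₗc[R] A) (g : C →ₗc[R] B) :
    (sndHom R A B).comp (pairHom f g) = g := by
  ext x
  conv_rhs => rw [← sum_counit_smul (ℛ R x)]
  simp [pairHom_apply, ← (ℛ R x).eq]

lemma pairHom_fstHom_sndHom : pairHom (fstHom R C D) (sndHom R C D) = CoalgHom.id R (C ⊗[R] D) := by
  apply CoalgHom.coe_linearMap_injective
  ext x y
  suffices TensorProduct.map (fstHom R C D).toLinearMap (sndHom R C D).toLinearMap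
      (comul (x ⊗ₜ[R] y)) = x ⊗ₜ y by simpa [pairHom_apply] using this
  rw [map_fstHom_left_comul_tmul]
  conv_rhs => rw [← sum_counit_right_smul (R := R) x]
  simp [TensorProduct.sum_tmul, TensorProduct.smul_tmul]

variable (R H) in
lemma antipode_convMul_comul [Coalgebra.IsCocomm R H] :
    toConv (TensorProduct.map (antipode R) (antipode R) ∘ₗ comul : H →ₗ[R] H ⊗[R] H) *
      toConv comul = 1 := by
  have h := LinearMap.convMul_comp_coalgHom_distrib
    (toConv (TensorProduct.map (antipode R (A := H)) (antipode R (A := H))))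
    (toConv (TensorProduct.map (id (R := R) (M := H)) id)) (comulCoalgHom R H)
  have hm := TensorProduct.map_convMul_map (R := R) (f := toConv (antipode R (A := H)))
    (g := toConv (antipode R (A := H))) (h := toConv id) (k := toConv id)
  rw [LinearMap.antipode_mul_id] at hm
  rw [hm] at h
  apply ofConv_injective
  rw [TensorProduct.map_id] at h
  refine Eq.trans h.symm ?_
  ext x
  change TensorProduct.map (Algebra.linearMap R H ∘ₗ counit) (Algebra.linearMap R H ∘ₗ counit)
    (comul x) = algebraMap R (H ⊗[R] H) (counit x)
  conv_rhs => rw [← sum_counit_right_smul (R := R) x]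
  conv_lhs => rw [← (ℛ R x).eq]
  simp [Algebra.algebraMap_eq_smul_one, ← TensorProduct.smul_tmul', TensorProduct.tmul_smul,
    Algebra.TensorProduct.one_def, mul_smul]

variable (R H) in
/-- The antipode of a cocommutative Hopf algebra as a coalgebra map. -/
noncomputable def antipodeCoalgHom [Coalgebra.IsCocomm R H] : H →ₗc[R] H where
  __ := antipode R
  counit_comp := by simp
  map_comp_comul := toConv_injective <|
    left_inv_eq_right_inv (antipode_convMul_comul R H) comul_right_inv

/-- The convolution product of two coalgebra maps out of a cocommutative coalgebra. -/
noncomputable def mulHom (f g : C →ₗc[R] H) : C →ₗc[R] H :=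
  (Bialgebra.mulCoalgHom R H).comp (pairHom f g)

lemma mulHom_comp (f g : C →ₗc[R] H) (h : D →ₗc[R] C) :
    (mulHom f g).comp h = mulHom (f.comp h) (g.comp h) := by
  rw [mulHom, mulHom, ← pairHom_comp]; rfl

lemma assoc_comp_pairHom (f g h : C →ₗc[R] H) :
    (TensorProduct.assoc R H H H).toLinearMap ∘ₗ (pairHom (pairHom f g) h).toLinearMap =
      (pairHom f (pairHom g h)).toLinearMap := by
  simp only [pairHom_toLinearMap]
  simp only [coassoc_simps]

variable [Coalgebra.IsCocomm R H]

/-- The conjugate `f⁻¹ * g * f` in the convolution group of coalgebra maps. -/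
noncomputable def conjHom (f g : C →ₗc[R] H) : C →ₗc[R] H :=
  mulHom (mulHom ((antipodeCoalgHom R H).comp f) g) f

lemma toConv_conjHom (f g : C →ₗc[R] H) :
    toConv (conjHom f g).toLinearMap =
      toConv (antipode R ∘ₗ f.toLinearMap) * toConv g.toLinearMap * toConv f.toLinearMap := rfl

lemma conjHom_comp (f g : C →ₗc[R] H) (h : D →ₗc[R] C) :
    (conjHom f g).comp h = conjHom (f.comp h) (g.comp h) := by
  simp only [conjHom, mulHom_comp]; rfl

lemma conjHom_conjHom (f g h : C →ₗc[R] H) :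
    conjHom (conjHom f g) (conjHom f h) = conjHom f (conjHom g h) := by
  apply CoalgHom.coe_linearMap_injective
  apply toConv_injective
  have hf := toConv_mul_antipode f
  have hg := toConv_mul_antipode g
  have hf' := toConv_antipode_mul f
  have hc := toConv_antipode_mul (conjHom f g)
  change toConv (conjHom _ _).toLinearMap = toConv (conjHom _ _).toLinearMap
  rw [toConv_conjHom] at hc
  rw [toConv_conjHom (conjHom f g), toConv_conjHom f (conjHom g h), toConv_conjHom g h,
    toConv_conjHom f g, toConv_conjHom f h]
  set F := toConv f.toLinearMap
  set G := toConv g.toLinearMap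
  set F' := toConv (antipode R ∘ₗ f.toLinearMap)
  set G' := toConv (antipode R ∘ₗ g.toLinearMap)
  have hw : toConv (antipode R ∘ₗ (conjHom f g).toLinearMap) = F' * G' * F := by
    refine left_inv_eq_right_inv hc ?_
    calc F' * G * F * (F' * G' * F) = F' * (G * (F * F') * G') * F := by simp only [mul_assoc]
      _ = 1 := by rw [hf, mul_one, hg, mul_one, hf']
  rw [hw]
  calc _ = F' * G' * (F * F') * toConv h.toLinearMap * (F * F') * G * F := by simp only [mul_assoc]
    _ = _ := by simp only [hf, mul_one, mul_assoc]

variable (R H) in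
/-- The map `x ⊗ y ↦ S(x₍₁₎) y x₍₂₎ ⊗ x₍₃₎`. -/
noncomputable def conjBraiding : H ⊗[R] H →ₗc[R] H ⊗[R] H :=
  pairHom (conjHom (fstHom R H H) (sndHom R H H)) (fstHom R H H)

lemma conjBraiding_comp_pairHom (f g : C →ₗc[R] H) :
    (conjBraiding R H).comp (pairHom f g) = pairHom (conjHom f g) f := by
  rw [conjBraiding, pairHom_comp, conjHom_comp, fstHom_comp_pairHom, sndHom_comp_pairHom]

lemma rTensor_conjBraiding_comp_pairHom (f g h : C →ₗc[R] H) :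
    rTensor H (conjBraiding R H).toLinearMap ∘ₗ (pairHom (pairHom f g) h).toLinearMap =
      (pairHom (pairHom (conjHom f g) f) h).toLinearMap := by
  rw [← conjBraiding_comp_pairHom]
  ext x
  simp [pairHom_apply, rTensor, TensorProduct.map_map]

lemma lTensor_conjBraiding_comp_pairHom (f g h : C →ₗc[R] H) :
    ((TensorProduct.assoc R H H H).symm.toLinearMap ∘ₗ lTensor H (conjBraiding R H).toLinearMap ∘ₗ
      (TensorProduct.assoc R H H H).toLinearMap) ∘ₗ (pairHom (pairHom f g) h).toLinearMap =
      (pairHom (pairHom f (conjHom g h)) g).toLinearMap := by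
  rw [comp_assoc, comp_assoc, assoc_comp_pairHom]
  have : lTensor H (conjBraiding R H).toLinearMap ∘ₗ (pairHom f (pairHom g h)).toLinearMap =
      (pairHom f (pairHom (conjHom g h) g)).toLinearMap := by
    rw [← conjBraiding_comp_pairHom]
    ext x
    simp [pairHom_apply, lTensor, TensorProduct.map_map]
  rw [this, ← assoc_comp_pairHom]
  ext x
  simp

lemma conjBraiding_braid :
    rTensor H (conjBraiding R H).toLinearMap ∘ₗ
      ((TensorProduct.assoc R H H H).symm.toLinearMap ∘ₗ
        lTensor H (conjBraiding R H).toLinearMap ∘ₗ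
          (TensorProduct.assoc R H H H).toLinearMap) ∘ₗ
      rTensor H (conjBraiding R H).toLinearMap =
    ((TensorProduct.assoc R H H H).symm.toLinearMap ∘ₗ
        lTensor H (conjBraiding R H).toLinearMap ∘ₗ
          (TensorProduct.assoc R H H H).toLinearMap) ∘ₗ
      rTensor H (conjBraiding R H).toLinearMap ∘ₗ
      ((TensorProduct.assoc R H H H).symm.toLinearMap ∘ₗ
        lTensor H (conjBraiding R H).toLinearMap ∘ₗ
          (TensorProduct.assoc R H H H).toLinearMap) := by
  set c₂ := (TensorProduct.assoc R H H H).symm.toLinearMap ∘ₗ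
    lTensor H (conjBraiding R H).toLinearMap ∘ₗ (TensorProduct.assoc R H H H).toLinearMap with hc₂
  have key (f g h : (H ⊗[R] H) ⊗[R] H →ₗc[R] H) :
      (rTensor H (conjBraiding R H).toLinearMap ∘ₗ c₂ ∘ₗ
          rTensor H (conjBraiding R H).toLinearMap) ∘ₗ (pairHom (pairHom f g) h).toLinearMap =
        (c₂ ∘ₗ rTensor H (conjBraiding R H).toLinearMap ∘ₗ c₂) ∘ₗ
          (pairHom (pairHom f g) h).toLinearMap := by
    simp only [comp_assoc, rTensor_conjBraiding_comp_pairHom]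
    rw [hc₂]
    simp only [lTensor_conjBraiding_comp_pairHom, rTensor_conjBraiding_comp_pairHom,
      conjHom_conjHom]
  have hid := key ((fstHom R H H).comp (fstHom R (H ⊗[R] H) H))
    ((sndHom R H H).comp (fstHom R (H ⊗[R] H) H)) (sndHom R (H ⊗[R] H) H)
  rw [← pairHom_comp, pairHom_fstHom_sndHom] at hid
  rw [CoalgHom.id_comp, pairHom_fstHom_sndHom] at hid
  exact hid

lemma conjBraiding_tmul (x y : H) :
    conjBraiding R H (x ⊗ₜ y) =
      ∑ i ∈ (ℛ R x).index, ∑ j ∈ (ℛ R ((ℛ R x).left i)).index,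
        (antipode R ((ℛ R ((ℛ R x).left i)).left j) * y * (ℛ R ((ℛ R x).left i)).right j) ⊗ₜ
          (ℛ R x).right i := by
  have h₁ (x : H) : (toConv (antipode R ∘ₗ (fstHom R H H).toLinearMap) *
      toConv (sndHom R H H).toLinearMap) (x ⊗ₜ y) = antipode R x * y := by
    have : (toConv (antipode R ∘ₗ (fstHom R H H).toLinearMap) *
      toConv (sndHom R H H).toLinearMap) (x ⊗ₜ y) = mul' R H (rTensor H (antipode R)
        (TensorProduct.map (fstHom R H H).toLinearMap (sndHom R H H).toLinearMap
          (comul (x ⊗ₜ[R] y)))) := by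
      simp [convMul_apply, rTensor, TensorProduct.map_map]
    rw [this, map_fstHom_left_comul_tmul]
    conv_rhs => rw [← sum_counit_right_smul (R := R) x]
    simp [Finset.sum_mul]
  rw [conjBraiding, pairHom_apply, map_fstHom_comul_tmul]
  refine Finset.sum_congr rfl fun i _ ↦ ?_
  rw [← TensorProduct.sum_tmul]
  congr 1
  refine (toConv_mul_fstHom_tmul _ _ _).trans ?_
  exact Finset.sum_congr rfl fun j _ ↦ congrArg (· * _) (h₁ _)

end CocommutativePoints

section TripleCoproduct

open Coalgebra

variable {R C : Type*} [CommSemiring R] [AddCommMonoid C] [Module R C] [Coalgebra R C]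

lemma lTensor_comul_comul (x : C) :
    lTensor C comul (comul x) =
      ∑ i ∈ (ℛ R x).index, ∑ j ∈ (ℛ R ((ℛ R x).left i)).index,
        (ℛ R ((ℛ R x).left i)).left j ⊗ₜ[R]
          ((ℛ R ((ℛ R x).left i)).right j ⊗ₜ[R] (ℛ R x).right i) := by
  rw [← coassoc_apply]
  conv_lhs => rw [← (ℛ R x).eq]
  simp only [map_sum, rTensor_tmul]
  refine Finset.sum_congr rfl fun i _ ↦ ?_
  conv_lhs => rw [← (ℛ R ((ℛ R x).left i)).eq]
  simp only [TensorProduct.sum_tmul, map_sum, TensorProduct.assoc_tmul]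

end TripleCoproduct

section InvolutiveAntipode

open Coalgebra HopfAlgebra

variable {R H : Type*} [CommSemiring R] [Semiring H] [HopfAlgebra R H]

lemma antipode_algebraMap (r : R) :
    antipode R (algebraMap R H r) = algebraMap R H r := by
  simp [Algebra.algebraMap_eq_smul_one]

lemma sum_right_mul_antipode_left (hS : ∀ x : H, antipode R (antipode R x) = x) (x : H) :
    ∑ i ∈ (ℛ R x).index, (ℛ R x).right i * antipode R ((ℛ R x).left i) =
      algebraMap R H (counit x) := by
  rw [← hS (∑ i ∈ _, _), map_sum]
  simp only [antipode_mul_antidistrib, hS]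
  rw [sum_mul_antipode_eq_algebraMap_counit, antipode_algebraMap]

lemma sum_antipode_right_mul_left (hS : ∀ x : H, antipode R (antipode R x) = x) (x : H) :
    ∑ i ∈ (ℛ R x).index, antipode R ((ℛ R x).right i) * (ℛ R x).left i =
      algebraMap R H (counit x) := by
  rw [← hS (∑ i ∈ _, _), map_sum]
  simp only [antipode_mul_antidistrib, hS]
  rw [sum_antipode_mul_eq_algebraMap_counit, antipode_algebraMap]

end InvolutiveAntipode

namespace HopfStr

variable {k} {V : Type u} [AddCommGroup V] [Module k V] [Coalgebra k V]

/-- The ring underlying a Hopf algebra structure. -/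
@[reducible]
def ring (hs : HopfStr k V) : Ring V where
  __ := (inferInstance : AddCommGroup V)
  mul a b := hs.mul (a ⊗ₜ b)
  one := hs.one
  left_distrib a b c := by
    change hs.mul _ = hs.mul _ + hs.mul _
    rw [TensorProduct.tmul_add, map_add]
  right_distrib a b c := by
    change hs.mul _ = hs.mul _ + hs.mul _
    rw [TensorProduct.add_tmul, map_add]
  zero_mul a := by
    change hs.mul _ = _
    rw [TensorProduct.zero_tmul, map_zero]
  mul_zero a := by
    change hs.mul _ = _
    rw [TensorProduct.tmul_zero, map_zero]
  mul_assoc := hs.mul_assoc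
  one_mul := hs.one_mul
  mul_one := hs.mul_one

/-- The algebra underlying a Hopf algebra structure. -/
@[reducible]
def algebra (hs : HopfStr k V) : letI := hs.ring; Algebra k V :=
  letI := hs.ring
  Algebra.ofModule
    (fun r x y ↦ by
      change hs.mul _ = r • hs.mul _
      rw [← TensorProduct.smul_tmul', map_smul])
    (fun r x y ↦ by
      change hs.mul _ = r • hs.mul _
      rw [TensorProduct.tmul_smul, map_smul])

lemma mul_eq_mul' (hs : HopfStr k V) :
    letI := hs.ring; letI := hs.algebra; hs.mul = LinearMap.mul' k V := by
  let := hs.ring; let := hs.algebra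
  ext a b
  rfl

/-- A Hopf algebra structure in the sense of `HopfStr` as an instance of `HopfAlgebra`. -/
@[reducible]
noncomputable def hopfAlgebra (hs : HopfStr k V) : letI := hs.ring; HopfAlgebra k V :=
  letI := hs.ring
  letI := hs.algebra
  letI : Bialgebra k V := Bialgebra.mk' k V hs.counit_one (hs.counit_mul _ _) hs.comul_one
    (by
      intro a b
      refine (hs.comul_mul a b).trans ?_
      rw [hs.mul_eq_mul']
      rw [← (Coalgebra.Repr.arbitrary k a).eq, ← (Coalgebra.Repr.arbitrary k b).eq]
      simp [TensorProduct.sum_tmul, TensorProduct.tmul_sum, Finset.sum_mul, Finset.mul_sum])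
  { antipode := hs.antipode
    mul_antipode_rTensor_comul := by
      rw [← hs.mul_eq_mul']
      refine hs.antipode_left.trans ?_
      ext x
      simp [Algebra.algebraMap_eq_smul_one]
      rfl
    mul_antipode_lTensor_comul := by
      rw [← hs.mul_eq_mul']
      refine hs.antipode_right.trans ?_
      ext x
      simp [Algebra.algebraMap_eq_smul_one]
      rfl }

open Coalgebra

/-- The opposite of a Hopf algebra structure with involutive antipode. -/
noncomputable def op (hs : HopfStr k V) (hS : ∀ v : V, hs.antipode (hs.antipode v) = v) :
    HopfStr k V where
  mul := hs.mul ∘ₗ (TensorProduct.comm k V V).toLinearMap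
  one := hs.one
  mul_assoc a b c := (hs.mul_assoc c b a).symm
  one_mul := hs.mul_one
  mul_one := hs.one_mul
  comul_mul a b := by
    refine (hs.comul_mul b a).trans ?_
    rw [← (ℛ k a).eq, ← (ℛ k b).eq]
    simp only [TensorProduct.sum_tmul, TensorProduct.tmul_sum, map_sum]
    exact Finset.sum_comm
  counit_mul a b := (hs.counit_mul b a).trans (mul_comm _ _)
  comul_one := hs.comul_one
  counit_one := hs.counit_one
  antipode := hs.antipode
  antipode_left := by
    let := hs.ring
    let := hs.algebra
    let := hs.hopfAlgebra
    ext x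
    have h := (sum_right_mul_antipode_left (R := k) hS x).trans
      (Algebra.algebraMap_eq_smul_one _)
    simp only [LinearMap.comp_apply]
    rw [← (ℛ k x).eq]
    simp only [map_sum]
    exact h
  antipode_right := by
    let := hs.ring
    let := hs.algebra
    let := hs.hopfAlgebra
    ext x
    have h := (sum_antipode_right_mul_left (R := k) hS x).trans
      (Algebra.algebraMap_eq_smul_one _)
    simp only [LinearMap.comp_apply]
    rw [← (ℛ k x).eq]
    simp only [map_sum]
    exact h

lemma brace_op (hs : HopfStr k V) (hS : ∀ v : V, hs.antipode (hs.antipode v) = v) :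
    (hs.op hS).mul ∘ₗ lTensor V hs.mul = braceRHS hs.mul hs.antipode (hs.op hS).mul := by
  let := hs.ring
  let := hs.algebra
  let := hs.hopfAlgebra
  ext x y z
  have h : lTensor V comul (comul x) =
      ∑ i ∈ (ℛ k x).index, ∑ j ∈ (ℛ k ((ℛ k x).left i)).index,
        (ℛ k ((ℛ k x).left i)).left j ⊗ₜ[k]
          ((ℛ k ((ℛ k x).left i)).right j ⊗ₜ[k] (ℛ k x).right i) :=
    lTensor_comul_comul x
  have hb : braceRHS hs.mul hs.antipode (hs.op hS).mul (x ⊗ₜ (y ⊗ₜ z)) =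
      ∑ i ∈ (ℛ k x).index, ∑ j ∈ (ℛ k ((ℛ k x).left i)).index,
        y * (ℛ k ((ℛ k x).left i)).left j *
          (HopfAlgebra.antipode k ((ℛ k ((ℛ k x).left i)).right j) *
            (z * (ℛ k x).right i)) := by
    simp only [braceRHS, LinearMap.comp_apply, rTensor_tmul, h, TensorProduct.sum_tmul, map_sum]
    rfl
  refine Eq.trans (b := y * z * x) rfl (Eq.trans ?_ hb.symm)
  have hj (i) : ∑ j ∈ (ℛ k ((ℛ k x).left i)).index,
        y * (ℛ k ((ℛ k x).left i)).left j *
          (HopfAlgebra.antipode k ((ℛ k ((ℛ k x).left i)).right j) *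
            (z * (ℛ k x).right i)) =
      y * z * (counit (R := k) ((ℛ k x).left i) • (ℛ k x).right i) := by
    calc _ = y * (∑ j ∈ (ℛ k ((ℛ k x).left i)).index, (ℛ k ((ℛ k x).left i)).left j *
          HopfAlgebra.antipode k ((ℛ k ((ℛ k x).left i)).right j)) *
            (z * (ℛ k x).right i) := by
          simp only [Finset.mul_sum, Finset.sum_mul, _root_.mul_assoc]
      _ = _ := by
          rw [HopfAlgebra.sum_mul_antipode_eq_algebraMap_counit]
          simp [Algebra.algebraMap_eq_smul_one, _root_.mul_assoc]
  simp only [hj, ← Finset.mul_sum, sum_counit_smul]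

end HopfStr
/-- (Example `1.1, 2)`). If `(H, ·, 1, Δ, ε, S)` is a Hopf algebra with
`S² = Id`, then `x ∘ y := y·x` gives a second Hopf algebra structure (with the same unit and
antipode) and `(H, ·, ∘, 1, Δ, ε, S, S)` is a Hopf brace.  Moreover, if `H` is cocommutative,
`c(x ⊗ y) = S(x₍₁₎)·y·x₍₂₎ ⊗ x₍₃₎` is a solution of the braid equation. -/
theorem statement12 {k : Type u} [Field k]
    {V : Type u} [AddCommGroup V] [Module k V] [Coalgebra k V]
    (hs : HopfStr k V) (hS2 : ∀ v : V, hs.antipode (hs.antipode v) = v) :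
    (∃ B : HopfBrace k V, B.dot = hs ∧
      (∀ x y : V, B.circ.mul (x ⊗ₜ[k] y) = hs.mul (y ⊗ₜ[k] x)) ∧
      B.circ.one = hs.one ∧ B.circ.antipode = hs.antipode) ∧
    (IsCocomm k V →
      ∀ c : V ⊗[k] V →ₗ[k] V ⊗[k] V,
        (∀ (x y : V) (ι : Type u) (s : Finset ι) (x1 x2 x3 : ι → V),
          (∑ i ∈ s, x1 i ⊗ₜ[k] (x2 i ⊗ₜ[k] x3 i) =
            lTensor V (Coalgebra.comul (R := k)) (Coalgebra.comul (R := k) x)) →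
          c (x ⊗ₜ[k] y) =
            ∑ i ∈ s, hs.mul (hs.mul (hs.antipode (x1 i) ⊗ₜ[k] y) ⊗ₜ[k] x2 i) ⊗ₜ[k] x3 i) →
        SolvesBraid c) := by
  refine ⟨⟨⟨hs, hs.op hS2, hs.brace_op hS2⟩, rfl, fun _ _ ↦ rfl, rfl, rfl⟩, ?_⟩
  intro hcocomm c hc
  let := hs.ring
  let := hs.algebra
  let := hs.hopfAlgebra
  have : Coalgebra.IsCocomm k V := ⟨hcocomm⟩
  have h : c = (conjBraiding k V).toLinearMap := by
    ext x y
    let r := Coalgebra.Repr.arbitrary k x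
    let q (i) := Coalgebra.Repr.arbitrary k (r.left i)
    refine (hc x y (Σ _ : V × V, V × V) (r.index.sigma fun i ↦ (q i).index)
      (fun p ↦ (q p.1).left p.2) (fun p ↦ (q p.1).right p.2) (fun p ↦ r.right p.1) ?_).trans ?_
    · rw [lTensor_comul_comul, Finset.sum_sigma]
    · rw [Finset.sum_sigma]
      exact (conjBraiding_tmul x y).symm
  rw [h]
  exact conjBraiding_braid

end HopfBraceNL
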